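/- Let X and Y be nonempty compact metric spaces. Define the Kuratowski–Gromov–Hausdorff distance d_{κ-GH}(X, Y) as the infimum (sInf in ℝ) of the set of real numbers hausdorffDist(range κ_u, range κ_v), taken over all sequences u : ℕ → X and v : ℕ → Y with dense range, where κ_u(x) = (n ↦ dist (u n) x) ∈ ℓ^∞ and κ_v(y) = (n ↦ dist (v n) y) ∈ ℓ^∞. Then ghDist(X, Y) ≤ d_{κ-GH}(X, Y) ≤ 2 · ghDist(X, Y). -/

import Mathlib

open Metric ENNReal

/-- The Kuratowski map of a compact metric space into `ℓ^∞`, defined from a sequence of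
points: `x ↦ (n ↦ dist (u n) x)`. -/
noncomputable def kuratowskiMap {X : Type*} [MetricSpace X] [CompactSpace X]
    (u : ℕ → X) (x : X) : lp (fun _ : ℕ => ℝ) ∞ :=
  ⟨fun n => dist (u n) x, memℓp_infty ⟨Metric.diam (Set.univ : Set X), by
    rintro r ⟨n, rfl⟩
    simpa [Real.norm_eq_abs, abs_of_nonneg dist_nonneg] using
      Metric.dist_le_diam_of_mem isCompact_univ.isBounded (Set.mem_univ (u n))
        (Set.mem_univ x)⟩⟩


theorem isometry_kuratowskiMap {X : Type*} [MetricSpace X] [CompactSpace X] {u : ℕ → X}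
    (hu : DenseRange u) : Isometry (kuratowskiMap u) := by
  refine Isometry.of_dist_eq fun x y => le_antisymm ?_ ?_
  · rw [dist_eq_norm]
    refine lp.norm_le_of_forall_le dist_nonneg fun n => ?_
    change |dist (u n) x - dist (u n) y| ≤ dist x y
    rw [dist_comm (u n) x, dist_comm (u n) y]
    exact abs_dist_sub_le x y (u n)
  · refine le_of_forall_pos_lt_add fun ε hε => ?_
    obtain ⟨n, hn⟩ := hu.exists_dist_lt x (half_pos hε)
    have h : |dist (u n) x - dist (u n) y| ≤ dist (kuratowskiMap u x) (kuratowskiMap u y) := by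
      rw [dist_eq_norm]
      exact lp.norm_apply_le_norm ENNReal.top_ne_zero (kuratowskiMap u x - kuratowskiMap u y) n
    have h' := (abs_le.mp h).1
    have h_tri := dist_triangle_left x y (u n)
    rw [dist_comm] at hn
    linarith

theorem dist_kuratowskiMap_le {X Y Z : Type*} [MetricSpace X] [CompactSpace X]
    [MetricSpace Y] [CompactSpace Y] [PseudoMetricSpace Z] {Φ : X → Z} {Ψ : Y → Z}
    (hΦ : Isometry Φ) (hΨ : Isometry Ψ) {u : ℕ → X} {v : ℕ → Y} {r : ℝ}
    (huv : ∀ n, dist (Φ (u n)) (Ψ (v n)) ≤ r) {x : X} {y : Y} (hxy : dist (Φ x) (Ψ y) ≤ r) :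
    dist (kuratowskiMap u x) (kuratowskiMap v y) ≤ 2 * r := by
  rw [dist_eq_norm]
  refine lp.norm_le_of_forall_le (by linarith [dist_nonneg.trans hxy]) fun n => ?_
  change |dist (u n) x - dist (v n) y| ≤ 2 * r
  rw [← hΦ.dist_eq, ← hΨ.dist_eq, ← Real.dist_eq]
  linarith [dist_dist_dist_le (Φ (u n)) (Φ x) (Ψ (v n)) (Ψ y), huv n]

/-- Dense sequences in two spaces can be merged along maps in both directions, so that their
terms correspond to each other under a relation containing the graphs of these maps. -/
theorem exists_denseRange_forall_rel {X Y : Type*} [TopologicalSpace X]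
    [TopologicalSpace.SeparableSpace X] [Nonempty X] [TopologicalSpace Y]
    [TopologicalSpace.SeparableSpace Y] [Nonempty Y] {R : X → Y → Prop}
    (hX : ∀ x, ∃ y, R x y) (hY : ∀ y, ∃ x, R x y) :
    ∃ (u : ℕ → X) (v : ℕ → Y), DenseRange u ∧ DenseRange v ∧ ∀ n, R (u n) (v n) := by
  choose f hf using hX
  choose g hg using hY
  let a := TopologicalSpace.denseSeq X
  let b := TopologicalSpace.denseSeq Y
  let e := Equiv.natSumNatEquivNat
  refine ⟨Sum.elim a (g ∘ b) ∘ e.symm, Sum.elim (f ∘ a) b ∘ e.symm, ?_, ?_, fun n => ?_⟩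
  · refine (TopologicalSpace.denseRange_denseSeq X).mono ?_
    rintro _ ⟨n, rfl⟩
    exact ⟨e (Sum.inl n), by simp [a]⟩
  · refine (TopologicalSpace.denseRange_denseSeq Y).mono ?_
    rintro _ ⟨n, rfl⟩
    exact ⟨e (Sum.inr n), by simp [b]⟩
  · rcases h : e.symm n with k | k
    · simpa [h] using hf (a k)
    · simpa [h] using hg (b k)

/-- The Kuratowski–Gromov–Hausdorff distance, the infimum of Hausdorff distances in `ℓ^∞`
between images of Kuratowski maps over all countable dense sequences, is squeezed between
the Gromov–Hausdorff distance and twice the Gromov–Hausdorff distance. -/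
theorem ghDist_le_kuratowskiGHDist_le_two_ghDist {X Y : Type}
    [MetricSpace X] [CompactSpace X] [Nonempty X]
    [MetricSpace Y] [CompactSpace Y] [Nonempty Y] :
    GromovHausdorff.ghDist X Y ≤
        sInf {r : ℝ | ∃ (u : ℕ → X) (v : ℕ → Y), DenseRange u ∧ DenseRange v ∧
          r = hausdorffDist (Set.range (kuratowskiMap u)) (Set.range (kuratowskiMap v))} ∧
      sInf {r : ℝ | ∃ (u : ℕ → X) (v : ℕ → Y), DenseRange u ∧ DenseRange v ∧
          r = hausdorffDist (Set.range (kuratowskiMap u)) (Set.range (kuratowskiMap v))} ≤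
        2 * GromovHausdorff.ghDist X Y := by
  constructor
  · refine le_csInf ⟨_, TopologicalSpace.denseSeq X, TopologicalSpace.denseSeq Y,
      TopologicalSpace.denseRange_denseSeq X, TopologicalSpace.denseRange_denseSeq Y, rfl⟩ ?_
    rintro _ ⟨u, v, hu, hv, rfl⟩
    exact GromovHausdorff.ghDist_le_hausdorffDist (isometry_kuratowskiMap hu)
      (isometry_kuratowskiMap hv)
  · obtain ⟨Φ, Ψ, hΦ, hΨ, hD⟩ := GromovHausdorff.ghDist_eq_hausdorffDist X Y
    refine le_of_forall_pos_le_add fun ε hε => ?_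
    set r := GromovHausdorff.ghDist X Y + ε / 2 with hr
    have hlt : hausdorffDist (Set.range Φ) (Set.range Ψ) < r := by linarith
    have hfin : hausdorffEDist (Set.range Φ) (Set.range Ψ) ≠ ⊤ :=
      hausdorffEDist_ne_top_of_nonempty_of_bounded (Set.range_nonempty _) (Set.range_nonempty _)
        (isCompact_range hΦ.continuous).isBounded (isCompact_range hΨ.continuous).isBounded
    have hX : ∀ x, ∃ y, dist (Φ x) (Ψ y) ≤ r := fun x => by
      obtain ⟨_, ⟨y, rfl⟩, hy⟩ :=
        exists_dist_lt_of_hausdorffDist_lt (Set.mem_range_self x) hlt hfin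
      exact ⟨y, hy.le⟩
    have hY : ∀ y, ∃ x, dist (Φ x) (Ψ y) ≤ r := fun y => by
      obtain ⟨_, ⟨x, rfl⟩, hx⟩ :=
        exists_dist_lt_of_hausdorffDist_lt' (Set.mem_range_self y) hlt hfin
      exact ⟨x, hx.le⟩
    obtain ⟨u, v, hu, hv, huv⟩ := exists_denseRange_forall_rel hX hY
    have hbdd : BddBelow {r : ℝ | ∃ (u : ℕ → X) (v : ℕ → Y), DenseRange u ∧ DenseRange v ∧
        r = hausdorffDist (Set.range (kuratowskiMap u)) (Set.range (kuratowskiMap v))} :=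
      ⟨0, by rintro _ ⟨u, v, -, -, rfl⟩; exact hausdorffDist_nonneg⟩
    refine (csInf_le hbdd ⟨u, v, hu, hv, rfl⟩).trans ?_
    rw [show 2 * GromovHausdorff.ghDist X Y + ε = 2 * r by rw [hr]; ring]
    refine hausdorffDist_le_of_mem_dist (by linarith [dist_nonneg.trans (huv 0)]) ?_ ?_
    · rintro _ ⟨x, rfl⟩
      obtain ⟨y, hxy⟩ := hX x
      exact ⟨_, ⟨y, rfl⟩, dist_kuratowskiMap_le hΦ hΨ huv hxy⟩
    · rintro _ ⟨y, rfl⟩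
      obtain ⟨x, hxy⟩ := hY y
      refine ⟨_, ⟨x, rfl⟩, ?_⟩
      rw [dist_comm]
      exact dist_kuratowskiMap_le hΦ hΨ huv hxy
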